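/- Let a and b be natural numbers with either (b ≡ 2 (mod 3) and a ≡ 2 (mod 3)) or (b ≡ 1 (mod 3) and a ≡ 0 (mod 3)) (the cases where the quantum XYZ cyclic code C(a,b) encodes three logical qubits), and set N = 2(a+b)+7. Then 3 divides gcd(a+b+2, N), and the kernel of the circulant matrix H_x over F_2 contains a vector v that is neither the zero vector nor the all-ones vector; that is, C(a,b) does not have repetition code structure under pure Pauli Z noise. -/

import Mathlib

open Matrix

instance (n : ℕ) : NeZero (2 * n + 7) := ⟨by omega⟩

/-- The circulant parity-check matrix `H_x` of the quantum XYZ cyclic code `C(a,b)`,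
whose symbol is the indicator function of `{0, a+b+2, a+b+4, 2(a+b)+6} ⊆ ZMod (2(a+b)+7)`. -/
def Hx (a b : ℕ) : Matrix (ZMod (2 * (a + b) + 7)) (ZMod (2 * (a + b) + 7)) (ZMod 2) :=
  Matrix.circulant fun i =>
    if i ∈ ({((0 : ℕ) : ZMod (2 * (a + b) + 7)), ((a + b + 2 : ℕ) : ZMod (2 * (a + b) + 7)),
        ((a + b + 4 : ℕ) : ZMod (2 * (a + b) + 7)),
        ((2 * (a + b) + 6 : ℕ) : ZMod (2 * (a + b) + 7))} : Finset (ZMod (2 * (a + b) + 7)))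
    then 1 else 0

/-- A circulant matrix with symbol the indicator function of `S` acts as the sum of the shifts
by the elements of `S`. -/
theorem circulant_indicator_mulVec {G R : Type*} [AddGroup G] [Fintype G] [DecidableEq G]
    [NonAssocSemiring R] (S : Finset G) (v : G → R) (i : G) :
    (Matrix.circulant (fun j => if j ∈ S then (1 : R) else 0) *ᵥ v) i =
      ∑ s ∈ S, v (-s + i) := by
  simp only [Matrix.mulVec, dotProduct, Matrix.circulant_apply, ite_mul, one_mul, zero_mul]
  rw [← Equiv.sum_comp (Equiv.subLeft i).symm]
  simp

/-- The four elements of the support of the symbol of `H_x` are distinct, so that a sum over the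
support has four terms. -/
theorem sum_shifts_Hx {M : Type*} [AddCommMonoid M] (n : ℕ) (f : ZMod (2 * n + 7) → M) :
    ∑ s ∈ ({((0 : ℕ) : ZMod (2 * n + 7)), ((n + 2 : ℕ) : ZMod (2 * n + 7)),
        ((n + 4 : ℕ) : ZMod (2 * n + 7)),
        ((2 * n + 6 : ℕ) : ZMod (2 * n + 7))} : Finset (ZMod (2 * n + 7))), f s =
      f (0 : ℕ) + (f (n + 2 : ℕ) + (f (n + 4 : ℕ) + f (2 * n + 6 : ℕ))) := by
  have hne : ∀ x y : ℕ, x < y → y < 2 * n + 7 →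
      (x : ZMod (2 * n + 7)) ≠ (y : ZMod (2 * n + 7)) := by
    intro x y hxy hy he
    rw [ZMod.natCast_eq_natCast_iff', Nat.mod_eq_of_lt (hxy.trans hy), Nat.mod_eq_of_lt hy] at he
    exact hxy.ne he
  have h₁ := hne 0 (n + 2) (by omega) (by omega)
  have h₂ := hne 0 (n + 4) (by omega) (by omega)
  have h₃ := hne 0 (2 * n + 6) (by omega) (by omega)
  have h₄ := hne (n + 2) (n + 4) (by omega) (by omega)
  have h₅ := hne (n + 2) (2 * n + 6) (by omega) (by omega)
  have h₆ := hne (n + 4) (2 * n + 6) (by omega) (by omega)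
  rw [Finset.sum_insert, Finset.sum_insert, Finset.sum_insert, Finset.sum_singleton] <;>
    simp only [Finset.mem_insert, Finset.mem_singleton, not_or] <;> tauto

/-- If `3 ∣ N`, every vector on `ZMod N` that factors through `ZMod 3` lies in the kernel of
`H_x`. -/
theorem Hx_mulVec_comp_castHom (a b : ℕ) (hab : (a + b) % 3 = 1)
    (hN : 3 ∣ 2 * (a + b) + 7) (w : ZMod 3 → ZMod 2) :
    Hx a b *ᵥ (w ∘ ZMod.castHom hN (ZMod 3)) = 0 := by
  have h₂ : ((a + b + 2 : ℕ) : ZMod 3) = (0 : ℕ) :=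
    (ZMod.natCast_eq_natCast_iff' _ _ _).2 (by omega)
  have h₄ : ((a + b + 4 : ℕ) : ZMod 3) = (2 : ℕ) :=
    (ZMod.natCast_eq_natCast_iff' _ _ _).2 (by omega)
  have h₆ : ((2 * (a + b) + 6 : ℕ) : ZMod 3) = (2 : ℕ) :=
    (ZMod.natCast_eq_natCast_iff' _ _ _).2 (by omega)
  funext i
  rw [Hx, circulant_indicator_mulVec, sum_shifts_Hx]
  simp only [Function.comp_apply, map_add, map_neg, map_natCast, h₂, h₄, h₆]
  rw [CharTwo.add_self_eq_zero, add_zero, CharTwo.add_self_eq_zero, Pi.zero_apply]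

/-- In the cases where the quantum XYZ cyclic code `C(a,b)` encodes three logical qubits
(`b ≡ 2, a ≡ 2 (mod 3)` or `b ≡ 1, a ≡ 0 (mod 3)`), with `N = 2(a+b)+7`: `3` divides
`gcd(a+b+2, N)`, and the kernel of `H_x` over `F_2` contains a vector that is neither the
zero vector nor the all-ones vector, i.e. `C(a,b)` does not have repetition code structure
under pure Pauli `Z` noise. -/
theorem xyz_three_logical_qubits_no_repetition_structure (a b : ℕ)
    (h : (b % 3 = 2 ∧ a % 3 = 2) ∨ (b % 3 = 1 ∧ a % 3 = 0)) :
    3 ∣ Nat.gcd (a + b + 2) (2 * (a + b) + 7) ∧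
    ∃ v : ZMod (2 * (a + b) + 7) → ZMod 2,
      Hx a b *ᵥ v = 0 ∧ v ≠ 0 ∧ ¬ (∀ i, v i = 1) := by
  have hN : 3 ∣ 2 * (a + b) + 7 := by omega
  refine ⟨Nat.dvd_gcd (by omega) hN, Pi.single 0 1 ∘ ZMod.castHom hN (ZMod 3),
    Hx_mulVec_comp_castHom a b (by omega) hN _, fun hv => ?_, fun hv => ?_⟩
  · simpa using congrFun hv 0
  · have h₁ := hv 1
    rw [Function.comp_apply, map_one] at h₁
    exact absurd h₁ (by decide)
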